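/- (Coercivity after perturbation.) Let $p\in\mathcal{P}^n_{\mathbb{K},+}[\mathbf{X}]$ admit a weighted SOS decomposition $p = \sum_j g_j\sum_i q_{ij}^2$, let $(\mathbf{x}_r)$ be a unisolvent set of points in $\mathbb{K}$ with linearly independent localizing matrices $B_r$, let $\varepsilon > 0$, and set $y_r^\varepsilon = p(\mathbf{x}_r) + \varepsilon\,\mathrm{tr}(B_r)$. Then the function $G^\varepsilon(\lambda) = \mathrm{tr}(M(\lambda)^{-1}) + \langle\lambda, y^\varepsilon\rangle$ is coercive on its domain: $G^\varepsilon(\lambda)\to+\infty$ as $\|\lambda\|\to\infty$. -/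

import Mathlib

open MvPolynomial Matrix BigOperators

/-- Multi-indices `α` with `|α| ≤ m`, each component bounded by `m`. -/
def MIdx (d m : ℕ) : Type := {α : Fin d → Fin (m + 1) // ∑ i, ((α i : ℕ)) ≤ m}

noncomputable instance (d m : ℕ) : Fintype (MIdx d m) := Subtype.fintype _
instance (d m : ℕ) : DecidableEq (MIdx d m) := Subtype.instDecidableEq

/-- The monomial `X^α` associated with a multi-index. -/
noncomputable def monIdx {d m : ℕ} (α : MIdx d m) : MvPolynomial (Fin d) ℝ :=
  ∏ i, (X i) ^ ((α.1 i : ℕ))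

/-- The block-diagonal polynomial-valued localizing matrix
`B(X) = diag (g_1(X) D^{n_1}(X), …, g_{j*}(X) D^{n_{j*}}(X))`,
with `D^{n_j}(X)_{αβ} = X^α X^β`. -/
noncomputable def BPoly {d js : ℕ} (g : Fin js → MvPolynomial (Fin d) ℝ)
    (nj : Fin js → ℕ) :
    Matrix ((j : Fin js) × MIdx d (nj j)) ((j : Fin js) × MIdx d (nj j))
      (MvPolynomial (Fin d) ℝ) :=
  fun p q => if p.1 = q.1 then g p.1 * monIdx p.2 * monIdx q.2 else 0

/-- Evaluation `B(x)` of the localizing matrix at a point. -/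
noncomputable def BEval {d js : ℕ} (g : Fin js → MvPolynomial (Fin d) ℝ)
    (nj : Fin js → ℕ) (x : Fin d → ℝ) :
    Matrix ((j : Fin js) × MIdx d (nj j)) ((j : Fin js) × MIdx d (nj j)) ℝ :=
  fun p q => eval x (BPoly g nj p q)


/-- `M(λ) = I + ∑ r λ_r B_r`. -/
noncomputable def Mmat {rs : ℕ} {ι : Type*} [Fintype ι] [DecidableEq ι]
    (B : Fin rs → Matrix ι ι ℝ) (lam : Fin rs → ℝ) : Matrix ι ι ℝ :=
  1 + ∑ r, lam r • B r

/-- The dual function `G(λ) = tr(M(λ)⁻¹) + ⟨λ, y⟩`. -/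
noncomputable def Gfun {rs : ℕ} {ι : Type*} [Fintype ι] [DecidableEq ι]
    (B : Fin rs → Matrix ι ι ℝ) (y : Fin rs → ℝ) (lam : Fin rs → ℝ) : ℝ :=
  (Mmat B lam)⁻¹.trace + ∑ r, y r * lam r

/-- The value of a polynomial of degree at most `m` is a linear combination of the values of the
monomials of degree at most `m`. -/
theorem exists_eval_eq_sum_monIdx {d m : ℕ} (q : MvPolynomial (Fin d) ℝ)
    (hq : q.totalDegree ≤ m) :
    ∃ c : MIdx d m → ℝ, ∀ x, eval x q = ∑ α, c α * eval x (monIdx α) := by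
  classical
  let e : MIdx d m → (Fin d →₀ ℕ) := fun α => Finsupp.equivFunOnFinite.symm fun i => (α.1 i : ℕ)
  have he : Function.Injective e := fun α β h => Subtype.ext <| funext fun i =>
    Fin.ext (DFunLike.congr_fun h i)
  have hsub : q.support ⊆ Finset.univ.image e := by
    intro s hs
    have hdeg : ∑ i, s i ≤ m := by
      have h := (le_totalDegree hs).trans hq
      rwa [Finsupp.sum_fintype _ _ fun _ => rfl] at h
    have hi (i : Fin d) : s i < m + 1 :=
      Nat.lt_succ_of_le <| (Finset.single_le_sum (f := fun i => s i)
        (fun _ _ => Nat.zero_le _) (Finset.mem_univ i)).trans hdeg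
    exact Finset.mem_image.2 ⟨⟨fun i => ⟨s i, hi i⟩, hdeg⟩, Finset.mem_univ _,
      Finsupp.ext fun _ => rfl⟩
  refine ⟨fun α => coeff (e α) q, fun x => ?_⟩
  rw [eval_eq', Finset.sum_subset hsub fun s _ hs => by rw [notMem_support_iff.1 hs, zero_mul],
    Finset.sum_image he.injOn]
  refine Finset.sum_congr rfl fun α _ => ?_
  simp [monIdx, e]

/-- The quadratic form of the localizing matrix at `x` evaluates the weighted square sum. -/
theorem dotProduct_BEval_mulVec {d js : ℕ} (g : Fin js → MvPolynomial (Fin d) ℝ)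
    (nj : Fin js → ℕ) (x : Fin d → ℝ) (v : (j : Fin js) × MIdx d (nj j) → ℝ) :
    v ⬝ᵥ (BEval g nj x *ᵥ v) =
      ∑ j, eval x (g j) * (∑ α, v ⟨j, α⟩ * eval x (monIdx α)) ^ 2 := by
  simp only [dotProduct, mulVec, Fintype.sum_sigma]
  refine Finset.sum_congr rfl fun j _ => ?_
  have hblock (α : MIdx d (nj j)) :
      ∑ k, ∑ β, BEval g nj x ⟨j, α⟩ ⟨k, β⟩ * v ⟨k, β⟩ =
        ∑ β, eval x (g j) * eval x (monIdx α) * eval x (monIdx β) * v ⟨j, β⟩ := by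
    rw [Finset.sum_eq_single j]
    · simp [BEval, BPoly]
    · intro k _ hk
      simp [BEval, BPoly, hk.symm]
    · simp
  simp only [hblock]
  rw [sq, Finset.sum_mul_sum, Finset.mul_sum]
  refine Finset.sum_congr rfl fun α _ => ?_
  rw [Finset.mul_sum, Finset.mul_sum]
  exact Finset.sum_congr rfl fun β _ => by ring

/-- Every entry of a real positive semidefinite matrix is bounded by the trace. -/
theorem Matrix.PosSemidef.abs_apply_le_trace {ι : Type*} [Fintype ι] [DecidableEq ι]
    {M : Matrix ι ι ℝ} (hM : M.PosSemidef) (a b : ι) : |M a b| ≤ M.trace := by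
  have hdiag (i : ι) : 0 ≤ M i i := hM.diag_nonneg
  have hle (i : ι) : M i i ≤ M.trace :=
    Finset.single_le_sum (f := fun i => M i i) (fun i _ => hdiag i) (Finset.mem_univ i)
  have hsymm : M b a = M a b := by simpa using hM.isHermitian.apply a b
  have hform (t : ℝ) : 0 ≤ M a a + t * M a b + t * (M b a + t * M b b) := by
    have h := hM.dotProduct_mulVec_nonneg (Pi.single a 1 + t • Pi.single b 1)
    simpa [mulVec_add, mulVec_smul, add_dotProduct, dotProduct_add, mul_add, add_assoc,
      add_comm, add_left_comm] using h
  have h1 := hform 1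
  have h2 := hform (-1)
  rw [abs_le]
  constructor <;> linarith [hle a, hle b]

/-- Coefficients of a linear combination of linearly independent matrices are controlled by a
uniform bound on the entries of the combination. -/
theorem exists_norm_le_mul_of_abs_sum_smul_apply_le {rs : ℕ} {ι : Type*} [Fintype ι]
    {B : Fin rs → Matrix ι ι ℝ} (hB : LinearIndependent ℝ B) :
    ∃ K : ℝ, 0 ≤ K ∧ ∀ (lam : EuclideanSpace ℝ (Fin rs)) (T : ℝ), 0 ≤ T →
      (∀ a b, |(∑ r, lam r • B r) a b| ≤ T) → ‖lam‖ ≤ K * T := by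
  let f : EuclideanSpace ℝ (Fin rs) →ₗ[ℝ] (ι → ι → ℝ) :=
    (Matrix.ofLinearEquiv ℝ).symm.toLinearMap ∘ₗ Fintype.linearCombination ℝ B ∘ₗ
      (WithLp.linearEquiv 2 ℝ (Fin rs → ℝ)).toLinearMap
  have hf : Function.Injective f :=
    (Matrix.ofLinearEquiv ℝ).symm.injective.comp
      ((hB.fintypeLinearCombination_injective).comp (WithLp.linearEquiv 2 ℝ _).injective)
  obtain ⟨K, -, hK⟩ := f.exists_antilipschitzWith (LinearMap.ker_eq_bot.2 hf)
  refine ⟨K, K.2, fun lam T hT h => ?_⟩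
  have hnorm : ‖f lam‖ ≤ T :=
    (pi_norm_le_iff_of_nonneg hT).2 fun a => (pi_norm_le_iff_of_nonneg hT).2 fun b => h a b
  have := hK.le_mul_dist lam 0
  rw [map_zero, dist_zero_right, dist_zero_right] at this
  exact this.trans (mul_le_mul_of_nonneg_left hnorm K.2)

/-- If `p` is a sum of quadratic forms at each `B r`, then pairing with its values is bounded below
on the domain where `M(λ)` is positive semidefinite. -/
theorem neg_sum_dotProduct_le_sum_mul {rs : ℕ} {ι κ : Type*} [Fintype ι] [DecidableEq ι]
    [Fintype κ] (B : Fin rs → Matrix ι ι ℝ) (v : κ → ι → ℝ) (lam : Fin rs → ℝ)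
    (hM : (Mmat B lam).PosSemidef) :
    -∑ i, v i ⬝ᵥ v i ≤ ∑ r, (∑ i, v i ⬝ᵥ (B r *ᵥ v i)) * lam r := by
  have hsum : ∑ r, (∑ i, v i ⬝ᵥ (B r *ᵥ v i)) * lam r =
      ∑ i, (v i ⬝ᵥ (Mmat B lam *ᵥ v i) - v i ⬝ᵥ v i) := by
    simp only [Finset.sum_mul]
    rw [Finset.sum_comm]
    refine Finset.sum_congr rfl fun i _ => ?_
    simp [Mmat, add_mulVec, sum_mulVec, smul_mulVec, dotProduct_sum, mul_comm]
  rw [hsum, ← Finset.sum_neg_distrib]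
  refine Finset.sum_le_sum fun i _ => ?_
  have := hM.dotProduct_mulVec_nonneg (v i)
  rw [star_trivial] at this
  linarith

theorem coercivity_after_perturbation
    (d js n rs : ℕ)
    (g : Fin js → MvPolynomial (Fin d) ℝ)
    (hgn : ∀ j, (g j).totalDegree ≤ n)
    (nj : Fin js → ℕ) (hnj : ∀ j, nj j = (n - (g j).totalDegree) / 2)
    (xr : Fin rs → Fin d → ℝ)
    (hxK : ∀ r, ∀ j, 0 ≤ eval (xr r) (g j))
    (l : Fin rs → MvPolynomial (Fin d) ℝ)
    (hldeg : ∀ r, (l r).totalDegree ≤ n)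
    (hdelta : ∀ r s, eval (xr s) (l r) = if r = s then (1 : ℝ) else 0)
    (huni : ∀ p : MvPolynomial (Fin d) ℝ, p.totalDegree ≤ n →
      p = ∑ r, C (eval (xr r) p) * l r)
    (hli : LinearIndependent ℝ (fun r => BEval g nj (xr r)))
    (p : MvPolynomial (Fin d) ℝ) (hpdeg : p.totalDegree ≤ n)
    (hpos : ∀ x : Fin d → ℝ, (∀ j, 0 ≤ eval x (g j)) → 0 ≤ eval x p)
    (hsos : ∃ q : Fin rs → Fin js → MvPolynomial (Fin d) ℝ,
        (∀ i j, (q i j).totalDegree ≤ nj j) ∧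
        p = ∑ j, g j * ∑ i, (q i j) ^ 2)
    (ε : ℝ) (hε : 0 < ε) :
    ∀ A : ℝ, ∃ R : ℝ, ∀ lam : EuclideanSpace ℝ (Fin rs),
      (Mmat (fun r => BEval g nj (xr r)) lam).PosDef → R ≤ ‖lam‖ →
        A ≤ Gfun (fun r => BEval g nj (xr r))
              (fun r => eval (xr r) p + ε * (BEval g nj (xr r)).trace) lam := by
  intro A
  obtain ⟨q, hqdeg, hpq⟩ := hsos
  choose c hc using fun i j => exists_eval_eq_sum_monIdx (q i j) (hqdeg i j)
  set B := fun r => BEval g nj (xr r) with hBdef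
  let v : Fin rs → ((j : Fin js) × MIdx d (nj j)) → ℝ := fun i a => c i a.1 a.2
  have hpv (r : Fin rs) : eval (xr r) p = ∑ i, v i ⬝ᵥ (B r *ᵥ v i) := by
    simp only [hBdef, dotProduct_BEval_mulVec]
    rw [Finset.sum_comm, hpq]
    simp [v, hc, Finset.mul_sum]
  obtain ⟨K, hK0, hK⟩ := exists_norm_le_mul_of_abs_sum_smul_apply_le hli
  set N : ℝ := (1 : Matrix ((j : Fin js) × MIdx d (nj j)) _ ℝ).trace with hN
  set V : ℝ := ∑ i, v i ⬝ᵥ v i with hV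
  let T : ℝ := max 0 ((A + V) / ε + N)
  refine ⟨K * (T + 1) + 1, fun lam hM hR => ?_⟩
  have hP := hM.posSemidef
  have hlow := neg_sum_dotProduct_le_sum_mul B v lam hP
  have htr : (Mmat B lam).trace = N + ∑ r, (B r).trace * lam r := by
    simp [Mmat, hN, trace_add, trace_sum, mul_comm]
  have hinv : 0 ≤ (Mmat B lam)⁻¹.trace := hP.inv.trace_nonneg
  have hG : Gfun B (fun r => eval (xr r) p + ε * (B r).trace) lam =
      (Mmat B lam)⁻¹.trace + ∑ r, (∑ i, v i ⬝ᵥ (B r *ᵥ v i)) * lam r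
        + ε * ((Mmat B lam).trace - N) := by
    rw [htr, add_sub_cancel_left]
    simp only [Gfun, hpv, add_mul, Finset.sum_add_distrib, Finset.mul_sum, mul_assoc, add_assoc]
  have hT : T ≤ (Mmat B lam).trace := by
    by_contra! hlt
    have hentry (a b) : |(∑ r, lam r • B r) a b| ≤ T + 1 := by
      have h1 := hP.abs_apply_le_trace a b
      have h2 : (∑ r, lam r • B r) a b =
          Mmat B lam a b - (1 : Matrix ((j : Fin js) × MIdx d (nj j)) _ ℝ) a b := by
        simp [Mmat]
      have h3 : |(1 : Matrix ((j : Fin js) × MIdx d (nj j)) _ ℝ) a b| ≤ 1 := by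
        rw [one_apply]; split_ifs <;> simp
      rw [h2]
      linarith [abs_sub (Mmat B lam a b)
        ((1 : Matrix ((j : Fin js) × MIdx d (nj j)) _ ℝ) a b)]
    linarith [hK lam (T + 1) (by positivity) hentry]
  have hmain : A + V ≤ ε * ((Mmat B lam).trace - N) := by
    have : (A + V) / ε ≤ (Mmat B lam).trace - N := by
      linarith [le_max_right 0 ((A + V) / ε + N)]
    rwa [div_le_iff₀' hε] at this
  rw [hG]
  linarith
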